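/- In the abelian group G = ℤ/3 × ℤ/3 × ℤ/5 × ℤ/5 (of order 225), the four 8-element subsets B₁ = {(0,0,0,0),(0,0,0,1),(0,1,0,3),(1,0,0,3),(1,2,1,0),(1,2,4,1),(2,1,1,2),(2,1,4,4)}, B₂ = {(0,0,0,0),(0,0,0,2),(0,1,2,1),(0,1,3,1),(0,2,2,2),(0,2,3,0),(2,1,0,1),(2,2,0,1)}, B₃ = {(0,0,0,0),(0,0,1,1),(1,0,0,1),(1,0,1,0),(1,2,3,3),(2,0,2,3),(2,0,4,3),(2,2,3,3)}, B₄ = {(0,0,0,0),(0,0,1,2),(1,1,2,3),(1,1,4,4),(1,2,3,1),(2,0,3,1),(2,2,2,0),(2,2,4,2)} form a (225,8,1)-difference family: every nonzero element g of G has exactly one representation g = x − y with x, y belonging to the same block Bᵢ. -/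

import Mathlib

def B4 : Fin 4 → Finset (ZMod 3 × ZMod 3 × ZMod 5 × ZMod 5) :=
  ![({(0, 0, 0, 0), (0, 0, 0, 1), (0, 1, 0, 3), (1, 0, 0, 3), (1, 2, 1, 0), (1, 2, 4, 1), (2, 1, 1, 2), (2, 1, 4, 4)} : Finset (ZMod 3 × ZMod 3 × ZMod 5 × ZMod 5)),
    ({(0, 0, 0, 0), (0, 0, 0, 2), (0, 1, 2, 1), (0, 1, 3, 1), (0, 2, 2, 2), (0, 2, 3, 0), (2, 1, 0, 1), (2, 2, 0, 1)} : Finset (ZMod 3 × ZMod 3 × ZMod 5 × ZMod 5)),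
    ({(0, 0, 0, 0), (0, 0, 1, 1), (1, 0, 0, 1), (1, 0, 1, 0), (1, 2, 3, 3), (2, 0, 2, 3), (2, 0, 4, 3), (2, 2, 3, 3)} : Finset (ZMod 3 × ZMod 3 × ZMod 5 × ZMod 5)),
    ({(0, 0, 0, 0), (0, 0, 1, 2), (1, 1, 2, 3), (1, 1, 4, 4), (1, 2, 3, 1), (2, 0, 3, 1), (2, 2, 2, 0), (2, 2, 4, 2)} : Finset (ZMod 3 × ZMod 3 × ZMod 5 × ZMod 5))]

theorem B4_card (i : Fin 4) : (B4 i).card = 8 := by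
  revert i
  decide +kernel

theorem exists_add_mem_B4 :
    ∀ g : ZMod 3 × ZMod 3 × ZMod 5 × ZMod 5, g ≠ 0 → ∃ i, ∃ y ∈ B4 i, g + y ∈ B4 i := by
  decide +kernel

/-- If the blocks have as many ordered pairs of distinct elements as the group has nonzero elements,
then representations of nonzero elements as differences are unique as soon as they all exist. -/
theorem existsUnique_sub_eq_of_exists_add_mem {ι G : Type*} [Fintype ι] [AddCommGroup G] [Fintype G]
    [DecidableEq G] (B : ι → Finset G)
    (hcard : ∑ i, (B i).offDiag.card ≤ Fintype.card G - 1)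
    (hB : ∀ g, g ≠ 0 → ∃ i, ∃ y ∈ B i, g + y ∈ B i) (g : G) (hg : g ≠ 0) :
    ∃! t : ι × G × G, t.2.1 ∈ B t.1 ∧ t.2.2 ∈ B t.1 ∧ t.2.1 - t.2.2 = g := by
  let pairs : Finset (Σ _ : ι, G × G) := Finset.univ.sigma fun i => (B i).offDiag
  have mem_pairs (i : ι) {x y : G} (hx : x ∈ B i) (hy : y ∈ B i) (hxy : x - y ≠ 0) :
      (⟨i, x, y⟩ : Σ _ : ι, G × G) ∈ pairs := by
    simpa [pairs, hx, hy] using sub_ne_zero.mp hxy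
  have hinj : Set.InjOn (fun p : Σ _ : ι, G × G => p.2.1 - p.2.2) pairs := by
    refine Finset.injOn_of_surjOn_of_card_le (t := Finset.univ.erase 0) _ ?_ ?_ ?_
    · rintro ⟨i, x, y⟩ h
      simpa [pairs, sub_eq_zero] using fun hxy => by simp_all [pairs]
    · intro d hd
      have hd0 : d ≠ 0 := by simpa using hd
      obtain ⟨i, y, hy, hx⟩ := hB d hd0
      exact ⟨⟨i, d + y, y⟩, mem_pairs i hx hy (by simpa using hd0), add_sub_cancel_right d y⟩
    · simpa [pairs, Finset.card_sigma, Finset.card_erase_of_mem] using hcard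
  obtain ⟨i, y, hy, hx⟩ := hB g hg
  refine ⟨(i, g + y, y), ⟨hx, hy, add_sub_cancel_right g y⟩, ?_⟩
  rintro ⟨j, u, v⟩ ⟨hu, hv, huv⟩
  dsimp only at hu hv huv
  have h := hinj (mem_pairs j hu hv (huv ▸ hg)) (mem_pairs i hx hy (by simpa using hg))
    (huv.trans (add_sub_cancel_right g y).symm)
  simpa using h

theorem stmt_4 :
    (∀ i : Fin 4, (B4 i).card = 8) ∧
    ∀ g : ZMod 3 × ZMod 3 × ZMod 5 × ZMod 5, g ≠ 0 →
      ∃! t : Fin 4 × (ZMod 3 × ZMod 3 × ZMod 5 × ZMod 5) × (ZMod 3 × ZMod 3 × ZMod 5 × ZMod 5),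
        t.2.1 ∈ B4 t.1 ∧ t.2.2 ∈ B4 t.1 ∧ t.2.1 - t.2.2 = g := by
  refine ⟨B4_card, existsUnique_sub_eq_of_exists_add_mem B4 ?_ exists_add_mem_B4⟩
  simp [Finset.offDiag_card, B4_card, ZMod.card]
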